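/- Let (R, m, k) be a commutative noetherian local ring and N a finitely generated Cohen–Macaulay R-module of dimension d, and set M := H^d_m(N), the top local cohomology module of N. Then for every integer i there is an isomorphism Tor_i^R(k, M) ≅ Tor_{i−d}^R(k, N); in particular Tor_i^R(k, M) = 0 for i < d and Tor_d^R(k, M) ≅ N/mN ≠ 0. -/

import Mathlib

open CategoryTheory Opposite

noncomputable section

/-- The `n`-th Ext group of `R`-modules `X` and `M`, i.e. `Ext^n_R(X, M)`. -/
def extModule (R : Type) [CommRing R] (n : ℕ) (X M : ModuleCat R) : ModuleCat R :=
  ((Ext R (ModuleCat R) n).obj (op X)).obj M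

/-- The `n`-th Tor group of `R`-modules `X` and `M`, i.e. `Tor_n^R(X, M)`. -/
def torModule (R : Type) [CommRing R] (n : ℕ) (X M : ModuleCat R) : ModuleCat R :=
  ((Tor (ModuleCat R) n).obj X).obj M

/-- The residue field `k(p) = R_p / p R_p` at a prime ideal `p`. -/
abbrev resField (R : Type) [CommRing R] (p : Ideal R) [p.IsPrime] : Type :=
  IsLocalRing.ResidueField (Localization.AtPrime p)

/-- `depth_R M := inf{ i : Ext^i_R(k, M) ≠ 0 }`, as an extended real (`⊤ = ∞` if all vanish). -/
noncomputable def edepth (R : Type) [CommRing R] (k M : ModuleCat R) : EReal :=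
  sInf {x : EReal | ∃ i : ℕ, x = (i : EReal) ∧ Nontrivial (extModule R i k M)}

/-- `width_R M := inf{ i : Tor_i^R(k, M) ≠ 0 }`, as an extended real (`⊤ = ∞` if all vanish). -/
noncomputable def ewidth (R : Type) [CommRing R] (k M : ModuleCat R) : EReal :=
  sInf {x : EReal | ∃ i : ℕ, x = (i : EReal) ∧ Nontrivial (torModule R i k M)}

/-- `sup{ i : Ext^i_R(k, M) ≠ 0 }`, as an extended real (`⊥ = -∞` if all vanish). -/
noncomputable def extSup (R : Type) [CommRing R] (k M : ModuleCat R) : EReal :=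
  sSup {x : EReal | ∃ i : ℕ, x = (i : EReal) ∧ Nontrivial (extModule R i k M)}

/-- `sup{ i : Tor_i^R(k, M) ≠ 0 }`, as an extended real (`⊥ = -∞` if all vanish). -/
noncomputable def torSup (R : Type) [CommRing R] (k M : ModuleCat R) : EReal :=
  sSup {x : EReal | ∃ i : ℕ, x = (i : EReal) ∧ Nontrivial (torModule R i k M)}

open Limits

section ExtOfResolution

variable {C : Type*} [Category* C] [Abelian C] [HasExt C] {X Y : C}
  (P : ProjectiveResolution X)

theorem CategoryTheory.ProjectiveResolution.extMk_eq_zero_iff_exists_next {n : ℕ}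
    (f : P.complex.X n ⟶ Y) (hf : P.complex.d (n + 1) n ≫ f = 0) :
    P.extMk f (n + 1) rfl hf = 0 ↔
      ∃ g : P.complex.X ((ComplexShape.down ℕ).next n) ⟶ Y,
        P.complex.d n ((ComplexShape.down ℕ).next n) ≫ g = f := by
  cases n with
  | succ n =>
    rw [P.extMk_eq_zero_iff f _ rfl hf n rfl]
    rw [ComplexShape.next_eq' (ComplexShape.down ℕ)
        (show (ComplexShape.down ℕ).Rel (n + 1) n from rfl)]
  | zero =>
    have h0 : ∀ j, P.complex.d 0 j = 0 := fun j => P.complex.shape _ _ (by simp)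
    have : P.extMk f 1 rfl hf = 0 ↔ f = 0 := by
      constructor
      · intro h
        rw [← P.extEquivCohomologyClass.apply_eq_iff_eq, P.extEquivCohomologyClass_extMk,
          P.extEquivCohomologyClass_zero,
          CochainComplex.HomComplex.CohomologyClass.mk_eq_zero_iff,
          CochainComplex.HomComplex.Cocycle.toSingleMk_mem_coboundaries_iff _ _ _ _ _ 1
            (by simp)] at h
        obtain ⟨g, hg⟩ := h
        have hz : P.cochainComplex.d (-(0 : ℕ) : ℤ) 1 = 0 := by
          apply IsZero.eq_of_tgt
          exact CochainComplex.isZero_of_isStrictlyLE P.cochainComplex 0 1 (by simp)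
        rw [hz, zero_comp] at hg
        rw [← cancel_epi (P.cochainComplexXIso (-(0 : ℕ) : ℤ) 0 rfl).hom, ← hg, comp_zero]
      · rintro rfl; simp
    rw [this]
    simp [eq_comm]

end ExtOfResolution

section
variable {R : Type} [CommRing R] {X Y : ModuleCat.{0} R} (P : ProjectiveResolution X)

theorem CategoryTheory.ProjectiveResolution.extMk_smul' {n : ℕ}
    (f : P.complex.X n ⟶ Y) (hf : P.complex.d (n + 1) n ≫ f = 0) (r : R)
    (hrf : P.complex.d (n + 1) n ≫ (r • f) = 0) :
    P.extMk (r • f) (n + 1) rfl hrf = r • P.extMk f (n + 1) rfl hf := by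
  rw [Abelian.Ext.smul_eq_comp_mk₀, P.extMk_comp_mk₀]
  simp

/-- Morphisms out of `P_n`, as a module. -/
def homMod (P : ChainComplex (ModuleCat.{0} R) ℕ) (n : ℕ) (Y : ModuleCat.{0} R) :
    Submodule R (P.X n ⟶ Y) where
  carrier := {f | P.d (n+1) n ≫ f = 0}
  add_mem' := by intro a b ha hb; simp_all
  zero_mem' := by simp
  smul_mem' := by intro a b ha; simp_all

/-- The classes in `Ext^n(X, Y)` of the morphisms `P_n ⟶ Y` vanishing on boundaries. -/
def extMkL (n : ℕ) (Y : ModuleCat.{0} R) : homMod P.complex n Y →ₗ[R] Abelian.Ext X Y n where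
  toFun f := P.extMk f.1 (n+1) rfl f.2
  map_add' := by intro a b; exact (P.add_extMk _ _ _ _ _ _).symm
  map_smul' := by intro r a; exact P.extMk_smul' _ _ _ _

end

section
variable {R : Type} [CommRing R]

section
variable {A B C : Type*} [AddCommGroup A] [AddCommGroup B] [AddCommGroup C] [Module R A]
  [Module R B] [Module R C]

/-- Two surjections with the same kernel have isomorphic targets. -/
def LinearEquiv.ofKerEq (f : A →ₗ[R] B) (g : A →ₗ[R] C) (hf : Function.Surjective f)
    (hg : Function.Surjective g) (h : LinearMap.ker f = LinearMap.ker g) : B ≃ₗ[R] C :=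
  (f.quotKerEquivOfSurjective hf).symm ≪≫ₗ Submodule.quotEquivOfEq _ _ h ≪≫ₗ
    g.quotKerEquivOfSurjective hg

theorem LinearEquiv.ofKerEq_apply (f : A →ₗ[R] B) (g : A →ₗ[R] C) (hf : Function.Surjective f)
    (hg : Function.Surjective g) (h : LinearMap.ker f = LinearMap.ker g) (a : A) :
    LinearEquiv.ofKerEq f g hf hg h (f a) = g a := by
  have : (f.quotKerEquivOfSurjective hf).symm (f a) = Submodule.Quotient.mk a := by
    rw [LinearEquiv.symm_apply_eq]; rfl
  simp only [LinearEquiv.ofKerEq, LinearEquiv.trans_apply, this]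
  rfl

end

/-- For a complex `K` in the opposite of the category of modules, the cycles of the unopped
complex. -/
theorem exists_unop_opcycles_iff (K : ChainComplex (ModuleCat.{0} R)ᵒᵖ ℕ) (n : ℕ)
    (x : (K.X n).unop) :
    (∃ z : (K.opcycles n).unop, (K.pOpcycles n).unop z = x) ↔ (K.d (n + 1) n).unop x = 0 := by
  have hex := (ShortComplex.exact_of_g_is_cokernel (ShortComplex.mk (K.d (n + 1) n)
    (K.pOpcycles n) (by simp)) (K.opcyclesIsCokernel (n + 1) n (by simp))).unop
  rw [ShortComplex.moduleCat_exact_iff] at hex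
  constructor
  · rintro ⟨z, rfl⟩
    have : (K.pOpcycles n).unop ≫ (K.d (n + 1) n).unop = 0 := by
      rw [← unop_comp]; simp
    exact ConcreteCategory.congr_hom this z
  · exact hex x

theorem homologyι_unop_eq_zero_iff (K : ChainComplex (ModuleCat.{0} R)ᵒᵖ ℕ) (n : ℕ)
    (z : (K.opcycles n).unop) :
    (K.homologyι n).unop z = 0 ↔ ∃ y : (K.X ((ComplexShape.down ℕ).next n)).unop,
      (K.d n ((ComplexShape.down ℕ).next n)).unop y = (K.pOpcycles n).unop z := by
  have hex := (ShortComplex.exact_of_f_is_kernel (ShortComplex.mk (K.homologyι n)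
    (K.fromOpcycles n _) (by simp)) (K.homologyIsKernel n _ rfl)).unop
  rw [ShortComplex.moduleCat_exact_iff] at hex
  have hd : K.d n ((ComplexShape.down ℕ).next n) = K.pOpcycles n ≫ K.fromOpcycles n _ := by simp
  have hinj : Function.Injective (K.pOpcycles n).unop :=
    (ModuleCat.mono_iff_injective _).1 inferInstance
  constructor
  · intro h
    obtain ⟨y, hy⟩ := hex z h
    refine ⟨y, ?_⟩
    rw [hd, ← hy]
    rfl
  · rintro ⟨y, hy⟩
    rw [hd] at hy
    have : (K.fromOpcycles n _).unop y = z := hinj hy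
    rw [← this]
    have : (K.fromOpcycles n ((ComplexShape.down ℕ).next n)).unop ≫ (K.homologyι n).unop = 0 := by
      rw [← unop_comp]; simp
    exact ConcreteCategory.congr_hom this y

variable {X : ModuleCat.{0} R} (P : ProjectiveResolution X) (n : ℕ) (Y : ModuleCat.{0} R)

/-- The complex `Hom(P, Y)`, in the opposite category. -/
abbrev yonedaComplex : ChainComplex (ModuleCat.{0} R)ᵒᵖ ℕ :=
  ((((linearYoneda R (ModuleCat.{0} R)).obj Y).rightOp.mapHomologicalComplex _).obj P.complex)

/-- `Ext^n(X, Y)` is the homology of `Hom(P, Y)`. -/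
def leftDerivedYonedaIso :
    (((linearYoneda R (ModuleCat.{0} R)).obj Y).rightOp.leftDerived n).obj X ≅
      (yonedaComplex P Y).homology n :=
  P.isoLeftDerivedObj ((linearYoneda R (ModuleCat.{0} R)).obj Y).rightOp n

/-- The projection from the cycles of `Hom(P, Y)` to `Ext^n(X, Y)`. -/
def toExtModule : ((yonedaComplex P Y).opcycles n).unop ⟶ extModule R n X Y :=
  ((leftDerivedYonedaIso P n Y).hom ≫ (yonedaComplex P Y).homologyι n).unop

theorem toExtModule_surjective : Function.Surjective (toExtModule P n Y) := by
  refine (ModuleCat.epi_iff_surjective _).1 ?_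
  exact unop_epi_of_mono ((leftDerivedYonedaIso P n Y).hom ≫ (yonedaComplex P Y).homologyι n)

theorem toExtModule_eq_zero_iff (z : ((yonedaComplex P Y).opcycles n).unop) :
    toExtModule P n Y z = 0 ↔ ∃ y : P.complex.X ((ComplexShape.down ℕ).next n) ⟶ Y,
      P.complex.d n ((ComplexShape.down ℕ).next n) ≫ y =
        ((yonedaComplex P Y).pOpcycles n).unop z := by
  rw [show toExtModule P n Y z = (leftDerivedYonedaIso P n Y).hom.unop
    (((yonedaComplex P Y).homologyι n).unop z) from rfl]
  have hinj : Function.Injective (leftDerivedYonedaIso P n Y).hom.unop :=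
    (ModuleCat.mono_iff_injective _).1 inferInstance
  erw [map_eq_zero_iff _ hinj]
  exact homologyι_unop_eq_zero_iff _ _ _

/-- The cycles of `Hom(P, Y)` as morphisms out of `P_n`. -/
def opcyclesToHomMod : ((yonedaComplex P Y).opcycles n).unop →ₗ[R] homMod P.complex n Y :=
  LinearMap.codRestrict _ ((yonedaComplex P Y).pOpcycles n).unop.hom
    (fun z => (exists_unop_opcycles_iff (yonedaComplex P Y) n _).1 ⟨z, rfl⟩)

theorem extMkL_apply (f : homMod P.complex n Y) :
    extMkL P n Y f = P.extMk f.1 (n + 1) rfl f.2 :=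
  rfl

theorem extMkL_eq_zero_iff (f : homMod P.complex n Y) : extMkL P n Y f = 0 ↔
    ∃ g : P.complex.X ((ComplexShape.down ℕ).next n) ⟶ Y,
      P.complex.d n ((ComplexShape.down ℕ).next n) ≫ g = f.1 :=
  P.extMk_eq_zero_iff_exists_next f.1 f.2

theorem extMkL_surjective : Function.Surjective (extMkL P n Y) := by
  intro e
  obtain ⟨f, hf, h⟩ := P.extMk_surjective e (n + 1) rfl
  exact ⟨⟨f, hf⟩, h⟩

theorem opcyclesToHomMod_surjective : Function.Surjective (opcyclesToHomMod P n Y) := by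
  rintro ⟨f, hf⟩
  obtain ⟨z, hz⟩ := (exists_unop_opcycles_iff (yonedaComplex P Y) n f).2 hf
  exact ⟨z, Subtype.ext hz⟩

/-- Comparison of the two definitions of `Ext`, through a projective resolution `P`. -/
def extCompare : extModule R n X Y ≃ₗ[R] Abelian.Ext X Y n :=
  LinearEquiv.ofKerEq (toExtModule P n Y).hom (extMkL P n Y ∘ₗ opcyclesToHomMod P n Y)
    (toExtModule_surjective P n Y)
    ((extMkL_surjective P n Y).comp (opcyclesToHomMod_surjective P n Y)) (by
      ext z
      rw [LinearMap.mem_ker, LinearMap.mem_ker]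
      exact (toExtModule_eq_zero_iff P n Y z).trans
        (P.extMk_eq_zero_iff_exists_next _ ((opcyclesToHomMod P n Y z).2)).symm)

theorem extCompare_toExtModule (z : ((yonedaComplex P Y).opcycles n).unop) :
    extCompare P n Y (toExtModule P n Y z) = extMkL P n Y (opcyclesToHomMod P n Y z) :=
  LinearEquiv.ofKerEq_apply _ _ _ _ _ z

theorem extCompare_naturality {X' : ModuleCat.{0} R} (P' : ProjectiveResolution X') (g : X' ⟶ X)
    (φ : ProjectiveResolution.Hom P' P g) (x : extModule R n X Y) :
    extCompare P' n Y (((Ext R (ModuleCat.{0} R) n).map g.op).app Y x) =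
      (Abelian.Ext.mk₀ g).comp (extCompare P n Y x) (zero_add n) := by
  obtain ⟨z, rfl⟩ := toExtModule_surjective P n Y x
  rw [extCompare_toExtModule]
  let F := ((linearYoneda R (ModuleCat.{0} R)).obj Y).rightOp
  let Φ : yonedaComplex P' Y ⟶ yonedaComplex P Y := (F.mapHomologicalComplex _).map φ.hom
  have hnat : toExtModule P n Y ≫ ((Ext R (ModuleCat.{0} R) n).map g.op).app Y =
      (HomologicalComplex.opcyclesMap Φ n).unop ≫ toExtModule P' n Y := by
    have h1 : (F.leftDerived n).map g ≫ (leftDerivedYonedaIso P n Y).hom =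
        (leftDerivedYonedaIso P' n Y).hom ≫ HomologicalComplex.homologyMap Φ n :=
      ProjectiveResolution.isoLeftDerivedObj_hom_naturality g P' P φ.hom
      (by simpa using φ.hom_f_zero_comp_π_f_zero) F n
    apply Quiver.Hom.op_inj
    change (F.leftDerived n).map g ≫ _ = _ ≫ _
    change (F.leftDerived n).map g ≫ ((leftDerivedYonedaIso P n Y).hom ≫ _) =
      ((leftDerivedYonedaIso P' n Y).hom ≫ _) ≫ _
    rw [reassoc_of% h1, Category.assoc, HomologicalComplex.homologyι_naturality]
  have hz : ((Ext R (ModuleCat.{0} R) n).map g.op).app Y (toExtModule P n Y z) =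
      toExtModule P' n Y ((HomologicalComplex.opcyclesMap Φ n).unop z) :=
    ConcreteCategory.congr_hom hnat z
  erw [hz, extCompare_toExtModule]
  rw [extMkL_apply, extMkL_apply, ProjectiveResolution.mk₀_comp_extMk _ (n + 1) rfl
    (opcyclesToHomMod P n Y z).2 φ]
  congr 1
  have := congrArg Quiver.Hom.unop (HomologicalComplex.p_opcyclesMap Φ n)
  exact ConcreteCategory.congr_hom this z

end

section
variable {R : Type} [CommRing R] (X Y : ModuleCat.{0} R) (n : ℕ)

/-- Comparison of the derived functor `Ext` with extension classes. -/
def extEquiv : extModule R n X Y ≃ₗ[R] Abelian.Ext X Y n :=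
  extCompare (ProjectiveResolution.of X) n Y

theorem extEquiv_naturality {X X' : ModuleCat.{0} R} (g : X' ⟶ X) (x : extModule R n X Y) :
    extEquiv X' Y n (((Ext R (ModuleCat.{0} R) n).map g.op).app Y x) =
      (Abelian.Ext.mk₀ g).comp (extEquiv X Y n x) (zero_add n) :=
  extCompare_naturality _ _ _ _ g ⟨ProjectiveResolution.lift g _ _,
    HomologicalComplex.congr_hom (ProjectiveResolution.lift_commutes g _ _) 0⟩ x
end

section ResidueVectorSpace

open IsLocalRing TensorProduct

variable {R : Type*} [CommRing R] [IsLocalRing R]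

/-- An injective map between modules killed by the maximal ideal splits. -/
theorem IsLocalRing.exists_leftInverse_of_injective {V W : Type*} [AddCommGroup V] [AddCommGroup W]
    [Module R V] [Module R W] (hW : ∀ r ∈ maximalIdeal R, ∀ w : W, r • w = 0)
    (ι : V →ₗ[R] W) (hι : Function.Injective ι) :
    ∃ s : W →ₗ[R] V, s ∘ₗ ι = LinearMap.id := by
  have hV : ∀ r ∈ maximalIdeal R, ∀ v : V, r • v = 0 := fun r hr v => hι (by simp [hW r hr])
  have hW' : Module.IsTorsionBySet R W (maximalIdeal R : Set R) := fun w r => hW r r.2 w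
  have hV' : Module.IsTorsionBySet R V (maximalIdeal R : Set R) := fun w r => hV r r.2 w
  let := hW'.module
  let := hV'.module
  let : Field (R ⧸ maximalIdeal R) := Ideal.Quotient.field _
  let ι' : V →ₗ[R ⧸ maximalIdeal R] W :=
    { toFun := ι, map_add' := map_add ι
      map_smul' := by
        intro c v
        obtain ⟨r, rfl⟩ := Ideal.Quotient.mk_surjective c
        exact ι.map_smul r v }
  obtain ⟨s, hs⟩ := ι'.exists_leftInverse_of_injective (LinearMap.ker_eq_bot.2 hι)
  refine ⟨{ toFun := s, map_add' := map_add s, map_smul' := ?_ }, ?_⟩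
  · intro r w
    exact s.map_smul (Ideal.Quotient.mk _ r) w
  · ext v
    exact LinearMap.congr_fun hs v

theorem IsLocalRing.exists_extend_of_injective {V W U : Type*} [AddCommGroup V] [AddCommGroup W]
    [AddCommGroup U] [Module R V] [Module R W] [Module R U]
    (hW : ∀ r ∈ maximalIdeal R, ∀ w : W, r • w = 0)
    (ι : V →ₗ[R] W) (hι : Function.Injective ι) (f : V →ₗ[R] U) :
    ∃ g : W →ₗ[R] U, g ∘ₗ ι = f := by
  obtain ⟨s, hs⟩ := exists_leftInverse_of_injective hW ι hι
  exact ⟨f ∘ₗ s, by rw [LinearMap.comp_assoc, hs, LinearMap.comp_id]⟩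

theorem ResidueField.smul_tensor_eq_zero {P : Type*} [AddCommGroup P] [Module R P]
    {r : R} (hr : r ∈ maximalIdeal R) (w : ResidueField R ⊗[R] P) : r • w = 0 := by
  induction w with
  | zero => simp
  | add x y hx hy => rw [smul_add, hx, hy, add_zero]
  | tmul c p =>
    rw [TensorProduct.smul_tmul', Algebra.smul_def, ResidueField.algebraMap_eq,
      (residue_eq_zero_iff r).2 hr, zero_mul, TensorProduct.zero_tmul]

theorem ResidueField.tensor_hom_ext {P U : Type*} [AddCommGroup P] [Module R P] [AddCommGroup U]
    [Module R U] {f g : ResidueField R ⊗[R] P →ₗ[R] U} (h : ∀ p, f (1 ⊗ₜ p) = g (1 ⊗ₜ p)) :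
    f = g := by
  ext c p
  obtain ⟨r, rfl⟩ := residue_surjective c
  have : residue R r ⊗ₜ[R] p = r • ((1 : ResidueField R) ⊗ₜ[R] p) := by
    rw [TensorProduct.smul_tmul', Algebra.smul_def, ResidueField.algebraMap_eq, mul_one]
  simp [this, h]

/-- The map `k ⊗ P → k` induced by a map `P → k`. -/
def ResidueField.tensorLift {P : Type*} [AddCommGroup P] [Module R P]
    (f : P →ₗ[R] ResidueField R) : ResidueField R ⊗[R] P →ₗ[R] ResidueField R :=
  LinearMap.mul' R (ResidueField R) ∘ₗ f.lTensor (ResidueField R)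

@[simp] theorem ResidueField.tensorLift_one_tmul {P : Type*} [AddCommGroup P] [Module R P]
    (f : P →ₗ[R] ResidueField R) (p : P) : tensorLift f (1 ⊗ₜ p) = f p := by
  simp [ResidueField.tensorLift]

variable {P₀ P₁ P₂ O T : Type*} [AddCommGroup P₀] [AddCommGroup P₁] [AddCommGroup P₂]
  [AddCommGroup O] [AddCommGroup T] [Module R P₀] [Module R P₁] [Module R P₂] [Module R O]
  [Module R T]

theorem ResidueField.comp_eq_zero_iff_exists (d₁ : P₁ →ₗ[R] P₀)
    (p : ResidueField R ⊗[R] P₁ →ₗ[R] O) (hp : Function.Surjective p)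
    (q : O →ₗ[R] ResidueField R ⊗[R] P₀) (hqp : q ∘ₗ p = d₁.lTensor _)
    (ι : T →ₗ[R] O) (hιq : Function.Exact ι q) (φ : O →ₗ[R] ResidueField R) :
    φ ∘ₗ ι = 0 ↔ ∃ y : P₀ →ₗ[R] ResidueField R, ∀ x, y (d₁ x) = φ (p (1 ⊗ₜ x)) := by
  constructor
  · intro h
    have hle : LinearMap.ker q ≤ LinearMap.ker φ := by
      intro o ho
      obtain ⟨t, rfl⟩ := (hιq o).1 ho
      exact LinearMap.congr_fun h t
    let φ' : (O ⧸ LinearMap.ker q) →ₗ[R] ResidueField R := (LinearMap.ker q).liftQ φ hle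
    let q' : (O ⧸ LinearMap.ker q) →ₗ[R] ResidueField R ⊗[R] P₀ := (LinearMap.ker q).liftQ q le_rfl
    have hq' : Function.Injective q' :=
      LinearMap.ker_eq_bot.1 (Submodule.ker_liftQ_eq_bot _ _ _ le_rfl)
    obtain ⟨g, hg⟩ := exists_extend_of_injective
      (fun r hr w => smul_tensor_eq_zero hr w) q' hq' φ'
    refine ⟨g ∘ₗ TensorProduct.mk R _ _ 1, fun x => ?_⟩
    have h1 : q (p (1 ⊗ₜ x)) = 1 ⊗ₜ d₁ x := by
      rw [← LinearMap.comp_apply, hqp]; simp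
    have h2 := LinearMap.congr_fun hg (Submodule.Quotient.mk (p (1 ⊗ₜ x)))
    change g (q (p (1 ⊗ₜ x))) = φ _ at h2
    rw [h1] at h2
    exact h2
  · rintro ⟨y, hy⟩
    have : tensorLift y ∘ₗ q ∘ₗ p = φ ∘ₗ p := by
      rw [hqp]
      apply tensor_hom_ext
      intro x
      simp [hy]
    have : tensorLift y ∘ₗ q = φ := by
      ext o
      obtain ⟨w, rfl⟩ := hp o
      exact LinearMap.congr_fun this w
    rw [← this, LinearMap.comp_assoc, hιq.linearMap_comp_eq_zero, LinearMap.comp_zero]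

theorem ResidueField.exists_apply_one_tmul_eq (d₂ : P₂ →ₗ[R] P₁)
    (p : ResidueField R ⊗[R] P₁ →ₗ[R] O) (hp : Function.Surjective p)
    (hex : Function.Exact (d₂.lTensor (ResidueField R)) p) (f : P₁ →ₗ[R] ResidueField R)
    (hf : f ∘ₗ d₂ = 0) : ∃ φ : O →ₗ[R] ResidueField R, ∀ x, φ (p (1 ⊗ₜ x)) = f x := by
  have hle : LinearMap.ker p ≤ LinearMap.ker (tensorLift f) := by
    intro w hw
    obtain ⟨v, rfl⟩ := (hex w).1 hw
    have : tensorLift f ∘ₗ d₂.lTensor _ = 0 := by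
      apply tensor_hom_ext
      intro x
      simpa using LinearMap.congr_fun hf x
    exact LinearMap.congr_fun this v
  refine ⟨(LinearMap.ker p).liftQ (tensorLift f) hle ∘ₗ
    (p.quotKerEquivOfSurjective hp).symm.toLinearMap, fun x => ?_⟩
  have : (p.quotKerEquivOfSurjective hp).symm (p (1 ⊗ₜ x)) = Submodule.Quotient.mk (1 ⊗ₜ x) := by
    rw [LinearEquiv.symm_apply_eq]; rfl
  simp [this]

end ResidueVectorSpace

section TorDual

open IsLocalRing TensorProduct

variable {R : Type} [CommRing R] [IsLocalRing R] {M : ModuleCat.{0} R}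
  (P : ProjectiveResolution M) (n : ℕ)

variable (R) in
/-- The residue field, as an object of the category of modules. -/
abbrev resCat : ModuleCat.{0} R := ModuleCat.of R (ResidueField R)

/-- The complex `k ⊗ P`. -/
abbrev tensorComplex : ChainComplex (ModuleCat.{0} R) ℕ :=
  (((MonoidalCategory.tensoringLeft (ModuleCat.{0} R)).obj (resCat R)).mapHomologicalComplex _).obj
    P.complex

/-- `Tor_n(k, M)` is the homology of `k ⊗ P`. -/
def torModuleIso : torModule R n (resCat R) M ≅ (tensorComplex P).homology n :=
  P.isoLeftDerivedObj ((MonoidalCategory.tensoringLeft (ModuleCat.{0} R)).obj (resCat R)) n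

/-- The inclusion of `Tor_n(k, M)` in the opcycles of `k ⊗ P`. -/
def torι : torModule R n (resCat R) M ⟶ (tensorComplex P).opcycles n :=
  (torModuleIso P n).hom ≫ (tensorComplex P).homologyι n

theorem torι_injective : Function.Injective (torι P n) :=
  (ModuleCat.mono_iff_injective _).1 (mono_comp _ _)

/-- The projection of `k ⊗ P_n` onto the opcycles. -/
def tensorPOpcycles : ResidueField R ⊗[R] P.complex.X n →ₗ[R] (tensorComplex P).opcycles n :=
  ((tensorComplex P).pOpcycles n).hom

theorem tensorPOpcycles_surjective : Function.Surjective (tensorPOpcycles P n) :=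
  (ModuleCat.epi_iff_surjective ((tensorComplex P).pOpcycles n)).1 inferInstance

/-- The map from the opcycles induced by the differential. -/
def tensorFromOpcycles (j : ℕ) :
    (tensorComplex P).opcycles n →ₗ[R] ResidueField R ⊗[R] P.complex.X j :=
  ((tensorComplex P).fromOpcycles n j).hom

theorem tensorFromOpcycles_comp (j : ℕ) : tensorFromOpcycles P n j ∘ₗ tensorPOpcycles P n =
    (P.complex.d n j).hom.lTensor _ := by
  have := congrArg ModuleCat.Hom.hom ((tensorComplex P).p_fromOpcycles n j)
  exact this

theorem exact_tensorPOpcycles : Function.Exact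
    ((P.complex.d (n + 1) n).hom.lTensor (ResidueField R))
    (tensorPOpcycles P n) := by
  have hex := (ShortComplex.exact_of_g_is_cokernel (ShortComplex.mk ((tensorComplex P).d (n + 1) n)
    ((tensorComplex P).pOpcycles n) ((tensorComplex P).d_pOpcycles _ _))
    ((tensorComplex P).opcyclesIsCokernel (n + 1) n (by simp)))
  rw [ShortComplex.ShortExact.moduleCat_exact_iff_function_exact] at hex
  exact hex

theorem exact_torι : Function.Exact (torι P n).hom
    (tensorFromOpcycles P n ((ComplexShape.down ℕ).next n)) := by
  have hex := (ShortComplex.exact_of_f_is_kernel (ShortComplex.mk ((tensorComplex P).homologyι n)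
    ((tensorComplex P).fromOpcycles n _) (by simp)) ((tensorComplex P).homologyIsKernel n _ rfl))
  rw [ShortComplex.ShortExact.moduleCat_exact_iff_function_exact] at hex
  intro o
  refine (hex o).trans ?_
  constructor
  · rintro ⟨t, rfl⟩
    refine ⟨(torModuleIso P n).inv t, ?_⟩
    have : (torModuleIso P n).inv ≫ torι P n = (tensorComplex P).homologyι n := by
      simp [torι]
    exact ConcreteCategory.congr_hom this t
  · rintro ⟨t, rfl⟩
    exact ⟨_, rfl⟩

theorem smul_opcycles_eq_zero {r : R} (hr : r ∈ maximalIdeal R)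
    (w : (tensorComplex P).opcycles n) : r • w = 0 := by
  obtain ⟨v, rfl⟩ := tensorPOpcycles_surjective P n w
  rw [← map_smul, ResidueField.smul_tensor_eq_zero hr, map_zero]

theorem smul_torModule_eq_zero {r : R} (hr : r ∈ maximalIdeal R)
    (w : torModule R n (resCat R) M) : r • w = 0 := by
  apply torι_injective (ProjectiveResolution.of M) n
  rw [map_zero, map_smul, smul_opcycles_eq_zero _ _ hr]

/-- The cocycle `P_n → k` attached to a functional on the opcycles of `k ⊗ P`. -/
def dualOpcyclesToHomMod : ((tensorComplex P).opcycles n →ₗ[R] ResidueField R) →ₗ[R]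
    homMod P.complex n (resCat R) where
  toFun φ := ⟨ModuleCat.ofHom (φ ∘ₗ tensorPOpcycles P n ∘ₗ TensorProduct.mk R _ _ 1), by
    change _ ≫ _ = _
    ext x
    have := (exact_tensorPOpcycles P n).linearMap_comp_eq_zero
    have := LinearMap.congr_fun this (1 ⊗ₜ x)
    exact (congrArg φ this).trans (map_zero φ)⟩
  map_add' _ _ := rfl
  map_smul' _ _ := rfl

theorem dualOpcyclesToHomMod_surjective : Function.Surjective (dualOpcyclesToHomMod P n) := by
  rintro ⟨f, hf⟩
  obtain ⟨φ, hφ⟩ := ResidueField.exists_apply_one_tmul_eq (P.complex.d (n + 1) n).hom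
    (tensorPOpcycles P n) (tensorPOpcycles_surjective P n) (exact_tensorPOpcycles P n) f.hom
    (congrArg ModuleCat.Hom.hom hf)
  refine ⟨φ, Subtype.ext ?_⟩
  ext x
  exact hφ x

/-- `Tor_n(k, M)` is dual to `Ext^n(M, k)`, through a projective resolution `P` of `M`. -/
def torDualEquivOfResolution :
    (torModule R n (resCat R) M →ₗ[R] ResidueField R) ≃ₗ[R] Abelian.Ext M (resCat R) n :=
  LinearEquiv.ofKerEq (LinearMap.lcomp R (ResidueField R) (torι P n).hom)
    (extMkL P n (resCat R) ∘ₗ dualOpcyclesToHomMod P n)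
    (fun f => IsLocalRing.exists_extend_of_injective
      (fun _ hr w => smul_opcycles_eq_zero P n hr w) _ (torι_injective P n) f)
    ((extMkL_surjective P n _).comp (dualOpcyclesToHomMod_surjective P n)) (by
      ext φ
      rw [LinearMap.mem_ker, LinearMap.mem_ker, LinearMap.comp_apply, extMkL_eq_zero_iff,
        LinearMap.lcomp_apply']
      rw [ResidueField.comp_eq_zero_iff_exists (P.complex.d n ((ComplexShape.down ℕ).next n)).hom
        (tensorPOpcycles P n) (tensorPOpcycles_surjective P n) _
        (tensorFromOpcycles_comp P n _) _ (exact_torι P n)]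
      constructor
      · rintro ⟨y, hy⟩
        refine ⟨ModuleCat.ofHom y, ?_⟩
        ext x
        exact hy x
      · rintro ⟨y, hy⟩
        exact ⟨y.hom, fun x => ConcreteCategory.congr_hom hy x⟩)

/-- `Tor_n(k, M)` is dual to `Ext^n(M, k)`. -/
def torDualEquiv (M : ModuleCat.{0} R) (n : ℕ) :
    (torModule R n (resCat R) M →ₗ[R] ResidueField R) ≃ₗ[R] Abelian.Ext M (resCat R) n :=
  torDualEquivOfResolution (ProjectiveResolution.of M) n

end TorDual

section DualLength

open IsLocalRing

variable {R : Type*} [CommRing R] [IsLocalRing R] {V W : Type} [AddCommGroup V] [Module R V]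
  [AddCommGroup W] [Module R W]

theorem IsLocalRing.length_dual [Module (ResidueField R) V] [IsScalarTower R (ResidueField R) V] :
    Module.length R (V →ₗ[R] ResidueField R) =
      Module.length (ResidueField R) (Module.Dual (ResidueField R) V) := by
  rw [← Module.length_eq_of_surjective (S := R) (R := ResidueField R) residue_surjective]
  exact LinearEquiv.length_eq (LinearMap.extendScalarsOfSurjectiveEquiv residue_surjective)

theorem IsLocalRing.nonempty_linearEquiv_of_length_dual_eq
    (hV : ∀ r ∈ maximalIdeal R, ∀ v : V, r • v = 0) (hW : ∀ r ∈ maximalIdeal R, ∀ w : W, r • w = 0)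
    (h : Module.length R (V →ₗ[R] ResidueField R) = Module.length R (W →ₗ[R] ResidueField R))
    (hfin : Module.length R (V →ₗ[R] ResidueField R) ≠ ⊤) : Nonempty (V ≃ₗ[R] W) := by
  have hW' : Module.IsTorsionBySet R W (maximalIdeal R : Set R) := fun w r => hW r r.2 w
  have hV' : Module.IsTorsionBySet R V (maximalIdeal R : Set R) := fun w r => hV r r.2 w
  let : Module (ResidueField R) V := hV'.module
  let : Module (ResidueField R) W := hW'.module
  have : IsScalarTower R (ResidueField R) V := hV'.isScalarTower
  have : IsScalarTower R (ResidueField R) W := hW'.isScalarTower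
  have key : ∀ (U : Type) [AddCommGroup U] [Module (ResidueField R) U],
      Module.length (ResidueField R) (Module.Dual (ResidueField R) U) ≠ ⊤ →
      Module.Finite (ResidueField R) U ∧ Module.length (ResidueField R)
        (Module.Dual (ResidueField R) U) = Module.finrank (ResidueField R) U := by
    intro U _ _ hU
    have hfl := (isFiniteLength_iff_isNoetherian_isArtinian.1 (Module.length_ne_top_iff.1 hU)).1
    have : Module.Finite (ResidueField R) (Module.Dual (ResidueField R) U) := inferInstance
    refine ⟨(Module.finite_dual_iff _).1 this, ?_⟩
    rw [Module.length_eq_finrank, Subspace.dual_finrank_eq]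
  rw [length_dual] at hfin
  rw [length_dual, length_dual] at h
  obtain ⟨f1, h1⟩ := key V hfin
  obtain ⟨f2, h2⟩ := key W (h ▸ hfin)
  rw [h1, h2] at h
  obtain ⟨e⟩ := FiniteDimensional.nonempty_linearEquiv_of_finrank_eq (R := ResidueField R)
    (M := V) (M' := W) (by exact_mod_cast h)
  exact ⟨e.restrictScalars R⟩

theorem IsLocalRing.subsingleton_of_length_dual_eq_zero
    (hV : ∀ r ∈ maximalIdeal R, ∀ v : V, r • v = 0)
    (h : Module.length R (V →ₗ[R] ResidueField R) = 0) : Subsingleton V := by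
  have := Module.length_eq_zero_iff.1 h
  obtain ⟨e⟩ := nonempty_linearEquiv_of_length_dual_eq (W := PUnit) hV
    (fun _ _ _ => Subsingleton.elim _ _) (by rw [h, eq_comm]; exact Module.length_eq_zero) (by simp)
  exact e.toEquiv.subsingleton

end DualLength

section ExtLength

open Abelian IsLocalRing

variable {R : Type} [CommRing R]

section
variable {S : ShortComplex (ModuleCat.{0} R)}

theorem length_ext_zero_of_precomp_f_eq_zero (hS : S.ShortExact) {Y : ModuleCat.{0} R}
    (h0 : ∀ α : Ext S.X₂ Y 0, (Ext.mk₀ S.f).comp α (zero_add 0) = 0) :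
    Module.length R (Ext S.X₃ Y 0) = Module.length R (Ext S.X₂ Y 0) := by
  have := hS.epi_g
  refine LinearEquiv.length_eq (LinearEquiv.ofBijective
    ((Ext.mk₀ S.g).precompOfLinear R Y (zero_add 0)) ⟨Ext.precomp_mk₀_injective_of_epi Y S.g, ?_⟩)
  intro α
  exact Ext.contravariant_sequence_exact₂ hS Y α (h0 α)

theorem length_ext_succ_of_precomp_f_eq_zero (hS : S.ShortExact) {Y : ModuleCat.{0} R}
    {n : ℕ}
    (h0 : ∀ α : Ext S.X₂ Y n, (Ext.mk₀ S.f).comp α (zero_add n) = 0)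
    (h1 : ∀ α : Ext S.X₂ Y (n + 1), (Ext.mk₀ S.f).comp α (zero_add (n + 1)) = 0) :
    Module.length R (Ext S.X₃ Y (n + 1)) =
      Module.length R (Ext S.X₁ Y n) + Module.length R (Ext S.X₂ Y (n + 1)) := by
  refine Module.length_eq_add_of_exact (hS.extClass.precompOfLinear R Y (add_comm 1 n))
    ((Ext.mk₀ S.g).precompOfLinear R Y (zero_add (n + 1))) ?_ ?_ ?_
  · rw [injective_iff_map_eq_zero]
    intro α hα
    obtain ⟨β, rfl⟩ := Ext.contravariant_sequence_exact₁ hS Y α (add_comm 1 n) hα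
    exact h0 β
  · intro α
    exact Ext.contravariant_sequence_exact₂ hS Y α (h1 α)
  · intro α
    constructor
    · intro hα
      exact Ext.contravariant_sequence_exact₃ hS Y α hα (add_comm 1 n)
    · rintro ⟨β, rfl⟩
      exact hS.comp_extClass_assoc β (add_comm 1 n)

theorem length_ext_zero_of_precomp_g_eq_zero (hS : S.ShortExact) {Y : ModuleCat.{0} R}
    (h0 : ∀ α : Ext S.X₃ Y 0, (Ext.mk₀ S.g).comp α (zero_add 0) = 0) :
    Module.length R (Ext S.X₃ Y 0) = 0 := by
  have := hS.epi_g
  rw [Module.length_eq_zero_iff]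
  have hinj := Ext.precomp_mk₀_injective_of_epi Y S.g
  exact ⟨fun a b => hinj ((h0 a).trans (h0 b).symm)⟩

theorem length_ext_of_precomp_g_eq_zero (hS : S.ShortExact) {Y : ModuleCat.{0} R}
    {n : ℕ}
    (h0 : ∀ α : Ext S.X₃ Y n, (Ext.mk₀ S.g).comp α (zero_add n) = 0)
    (h1 : ∀ α : Ext S.X₃ Y (n + 1), (Ext.mk₀ S.g).comp α (zero_add (n + 1)) = 0) :
    Module.length R (Ext S.X₁ Y n) =
      Module.length R (Ext S.X₂ Y n) + Module.length R (Ext S.X₃ Y (n + 1)) := by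
  refine Module.length_eq_add_of_exact ((Ext.mk₀ S.f).precompOfLinear R Y (zero_add n))
    (hS.extClass.precompOfLinear R Y (add_comm 1 n)) ?_ ?_ ?_
  · rw [injective_iff_map_eq_zero]
    intro α hα
    obtain ⟨β, rfl⟩ := Ext.contravariant_sequence_exact₂ hS Y α hα
    exact h0 β
  · intro α
    exact Ext.contravariant_sequence_exact₃ hS Y α (h1 α) (add_comm 1 n)
  · intro α
    constructor
    · intro hα
      exact Ext.contravariant_sequence_exact₁ hS Y α (add_comm 1 n) hα
    · rintro ⟨β, rfl⟩
      exact hS.extClass_comp_assoc β (h := add_comm 1 n)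
end

variable [IsLocalRing R]

theorem smul_ext_resCat_eq_zero {r : R} (hr : r ∈ maximalIdeal R) {M : ModuleCat.{0} R} {n : ℕ}
    (α : Ext M (resCat R) n) : r • α = 0 := by
  have : r • 𝟙 (resCat R) = 0 := by
    ext c
    change r • c = 0
    rw [Algebra.smul_def, ResidueField.algebraMap_eq, (residue_eq_zero_iff r).2 hr, zero_mul]
  rw [Ext.smul_eq_comp_mk₀, this, Ext.mk₀_zero, Ext.comp_zero]

theorem mk₀_smul_id_comp_ext_resCat {r : R} (hr : r ∈ maximalIdeal R) {M : ModuleCat.{0} R} {n : ℕ}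
    (α : Ext M (resCat R) n) : (Ext.mk₀ (r • 𝟙 M)).comp α (zero_add n) = 0 := by
  rw [Ext.mk₀_smul, Ext.smul_comp, smul_ext_resCat_eq_zero hr]

/-- The dimension of `Ext^n(M, k)`, as the length of an `R`-module. -/
def bassLength (n : ℕ) (M : ModuleCat.{0} R) : ℕ∞ := Module.length R (Ext M (resCat R) n)

theorem bassLength_eq_of_iso {M M' : ModuleCat.{0} R} (e : M ≅ M') (n : ℕ) :
    bassLength n M = bassLength n M' := by
  refine LinearEquiv.length_eq (LinearEquiv.ofLinearMap
    ((Ext.mk₀ e.inv).precompOfLinear R _ (zero_add n))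
    ((Ext.mk₀ e.hom).precompOfLinear R _ (zero_add n)) ?_ ?_)
  · ext α
    change (Ext.mk₀ e.inv).comp ((Ext.mk₀ e.hom).comp α (zero_add n)) (zero_add n) = α
    simp
  · ext α
    change (Ext.mk₀ e.hom).comp ((Ext.mk₀ e.inv).comp α (zero_add n)) (zero_add n) = α
    simp

theorem bassLength_ne_top [IsNoetherianRing R] (M : ModuleCat.{0} R) [Module.Finite R M] (n : ℕ) :
    bassLength n M ≠ ⊤ := by
  have hfin : Module.Finite R (Ext M (resCat R) n) := inferInstance
  have htor : Module.IsTorsionBySet R (Ext M (resCat R) n) (maximalIdeal R : Set R) :=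
    fun w r => smul_ext_resCat_eq_zero r.2 w
  let : Module (ResidueField R) (Ext M (resCat R) n) := htor.module
  have : IsScalarTower R (ResidueField R) (Ext M (resCat R) n) := htor.isScalarTower
  have : Module.Finite (ResidueField R) (Ext M (resCat R) n) :=
    Module.Finite.of_restrictScalars_finite R _ _
  rw [bassLength, Module.length_eq_of_surjective (R := ResidueField R) residue_surjective]
  exact Module.length_ne_top

end ExtLength

section LocalCohomologyModel

open Abelian

variable {R : Type} [CommRing R] (J : Ideal R)

/-- The module `R / J ^ t`. -/
abbrev quotPow (t : ℕ) : ModuleCat.{0} R := ModuleCat.of R (R ⧸ J ^ t)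

/-- The projection `R / J ^ t ⟶ R / J ^ s` for `s ≤ t`. -/
def quotPowMap {s t : ℕ} (h : s ≤ t) : quotPow J t ⟶ quotPow J s :=
  ModuleCat.ofHom (Submodule.mapQ _ _ LinearMap.id (Ideal.pow_le_pow_right h))

theorem quotPowMap_refl (t : ℕ) : quotPowMap J (le_refl t) = 𝟙 _ := by
  ext
  rfl

theorem quotPowMap_comp {s t u : ℕ} (h : s ≤ t) (h' : t ≤ u) :
    quotPowMap J h' ≫ quotPowMap J h = quotPowMap J (h.trans h') := by
  ext
  rfl

variable (N N' N'' : ModuleCat.{0} R) (n : ℕ)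

/-- The transition maps `Ext^n(R / J ^ s, N) → Ext^n(R / J ^ t, N)`. -/
abbrev quotPowExtMap (s t : ℕ) (h : s ≤ t) : Ext (quotPow J s) N n →ₗ[R] Ext (quotPow J t) N n :=
  (Ext.mk₀ (quotPowMap J h)).precompOfLinear R N (zero_add n)

theorem quotPowExtMap_apply {s t : ℕ} (h : s ≤ t) (α : Ext (quotPow J s) N n) :
    quotPowExtMap J N n s t h α = (Ext.mk₀ (quotPowMap J h)).comp α (zero_add n) :=
  rfl

instance : DirectedSystem (fun t : ℕ => Ext (quotPow J t) N n)
    (fun s t h => quotPowExtMap J N n s t h) where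
  map_self t α := by
    rw [quotPowExtMap_apply, quotPowMap_refl, Ext.mk₀_id_comp]
  map_map s t u h h' α := by
    rw [quotPowExtMap_apply, quotPowExtMap_apply, quotPowExtMap_apply, Ext.mk₀_comp_mk₀_assoc,
      quotPowMap_comp]

/-- The direct limit of `Ext^n(R / J ^ t, N)` as a quotient of a direct sum. -/
abbrev ExtColim : Type := Module.DirectLimit (fun t : ℕ => Ext (quotPow J t) N n)
    (quotPowExtMap J N n)

namespace ExtColim

/-- The canonical map from a term to the direct limit. -/
def of (t : ℕ) : Ext (quotPow J t) N n →ₗ[R] ExtColim J N n :=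
  Module.DirectLimit.of R ℕ (fun t : ℕ => Ext (quotPow J t) N n) (quotPowExtMap J N n) t

variable {N N' N''} {n}

theorem exists_of (z : ExtColim J N n) : ∃ t α, of J N n t α = z :=
  Module.DirectLimit.exists_of z

theorem of_comp {s t : ℕ} (h : s ≤ t) (α : Ext (quotPow J s) N n) :
    of J N n t ((Ext.mk₀ (quotPowMap J h)).comp α (zero_add n)) = of J N n s α :=
  Module.DirectLimit.of_f (f := quotPowExtMap J N n) (hij := h)

theorem of_eq_zero_iff {t : ℕ} {α : Ext (quotPow J t) N n} : of J N n t α = 0 ↔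
    ∃ (u : ℕ) (h : t ≤ u), (Ext.mk₀ (quotPowMap J h)).comp α (zero_add n) = 0 := by
  constructor
  · intro h
    exact Module.DirectLimit.of.zero_exact (f := quotPowExtMap J N n) h
  · rintro ⟨u, h, hu⟩
    rw [← of_comp J h, hu, map_zero]

theorem exists_pow_smul_eq_zero (z : ExtColim J N n) : ∃ t, ∀ r ∈ J ^ t, r • z = 0 := by
  obtain ⟨t, α, rfl⟩ := exists_of J z
  refine ⟨t, fun r hr => ?_⟩
  have h0 : r • 𝟙 (quotPow J t) = 0 := by
    ext
    change r • (1 : R ⧸ J ^ t) = 0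
    rw [Algebra.smul_def, mul_one]
    exact Ideal.Quotient.eq_zero_iff_mem.2 hr
  have : r • α = 0 := by
    conv_lhs => rw [← Ext.mk₀_id_comp α, ← Ext.smul_comp, ← Ext.mk₀_smul, h0, Ext.mk₀_zero,
      Ext.zero_comp]
  rw [← map_smul, this, map_zero]

theorem postcomp_compat {b m : ℕ} (β : Ext N N' b) (h : n + b = m) (s t : ℕ) (hst : s ≤ t) :
    β.postcompOfLinear R (quotPow J t) h ∘ₗ quotPowExtMap J N n s t hst =
      quotPowExtMap J N' m s t hst ∘ₗ β.postcompOfLinear R (quotPow J s) h := by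
  refine LinearMap.ext fun α => ?_
  exact Ext.comp_assoc (Ext.mk₀ (quotPowMap J hst)) α β (zero_add n) h (by omega)

/-- Postcomposition with an extension class. -/
def postcomp {b m : ℕ} (β : Ext N N' b) (h : n + b = m) : ExtColim J N n →ₗ[R] ExtColim J N' m :=
  Module.DirectLimit.map (f := quotPowExtMap J N n) (f' := quotPowExtMap J N' m)
    (fun t => β.postcompOfLinear R (quotPow J t) h) (postcomp_compat J β h)

theorem postcomp_of {b m : ℕ} (β : Ext N N' b) (h : n + b = m) (t : ℕ)
    (α : Ext (quotPow J t) N n) :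
    postcomp J β h (of J N n t α) = of J N' m t (α.comp β h) :=
  Module.DirectLimit.map_apply_of (f := quotPowExtMap J N n) (f' := quotPowExtMap J N' m)
    (fun t => β.postcompOfLinear R (quotPow J t) h) (postcomp_compat J β h) α

theorem exact_postcomp {b m b' m' : ℕ} (β : Ext N N' b) (h : n + b = m) (β' : Ext N' N'' b')
    (h' : m + b' = m') (h0 : β.comp β' rfl = 0)
    (hex : ∀ (X : ModuleCat.{0} R) (α : Ext X N' m), α.comp β' h' = 0 →
      ∃ γ : Ext X N n, γ.comp β h = α) :
    Function.Exact (postcomp J β h) (postcomp J β' h') := by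
  intro z
  obtain ⟨t, α, rfl⟩ := exists_of J z
  constructor
  · intro hz
    rw [postcomp_of, of_eq_zero_iff] at hz
    obtain ⟨u, htu, hu⟩ := hz
    rw [← Ext.comp_assoc _ _ _ (zero_add m) h' (by omega)] at hu
    obtain ⟨γ, hγ⟩ := hex _ _ hu
    refine ⟨of J N n u γ, ?_⟩
    rw [postcomp_of, hγ, of_comp]
  · rintro ⟨y, hy⟩
    obtain ⟨s, γ, rfl⟩ := exists_of J y
    rw [← hy, postcomp_of, postcomp_of, Ext.comp_assoc _ _ _ h rfl (by omega), h0, Ext.comp_zero,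
      map_zero]

theorem postcomp_smul_id (r : R) (z : ExtColim J N n) :
    postcomp J (Ext.mk₀ (r • 𝟙 N)) (add_zero n) z = r • z := by
  obtain ⟨t, α, rfl⟩ := exists_of J z
  rw [postcomp_of, ← Ext.smul_eq_comp_mk₀, map_smul]

end ExtColim

end LocalCohomologyModel

section Comparison

open Abelian

variable {R : Type} [CommRing R] (J : Ideal R) (N : ModuleCat.{0} R) (n : ℕ)

/-- The diagram of functors whose colimit is local cohomology. -/
abbrev lcDiagram : (ℕᵒᵖ)ᵒᵖ ⥤ ModuleCat.{0} R ⥤ ModuleCat.{0} R :=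
  localCohomology.diagram (localCohomology.idealPowersDiagram J) n

/-- The diagram of modules whose colimit is the local cohomology of `N`. -/
abbrev lcDiagramEval : (ℕᵒᵖ)ᵒᵖ ⥤ ModuleCat.{0} R :=
  lcDiagram J n ⋙ (evaluation (ModuleCat.{0} R) (ModuleCat.{0} R)).obj N

/-- Local cohomology of `N` as a colimit of modules. -/
def localCohomologyObjIso : (localCohomology J n).obj N ≅ colimit (lcDiagramEval J N n) :=
  colimitObjIsoColimitCompEvaluation (lcDiagram J n) N

/-- The terms of the diagram computing local cohomology, in terms of extension classes. -/
def evalEquiv (t : ℕ) :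
    (lcDiagramEval J N n).obj (op (op t)) ≃ₗ[R] Ext (quotPow J t) N n :=
  extEquiv (quotPow J t) N n

theorem evalEquiv_map {s t : ℕ} (h : s ≤ t)
    (f : op (op s) ⟶ op (op t)) (x : (lcDiagramEval J N n).obj (op (op s))) :
    evalEquiv J N n t ((lcDiagramEval J N n).map f x) =
      (Ext.mk₀ (quotPowMap J h)).comp (evalEquiv J N n s x) (zero_add n) :=
  extEquiv_naturality N n (quotPowMap J h) x

/-- The canonical map from `Ext^n(R / J ^ t, N)` to the colimit. -/
def toColimit (t : ℕ) : Ext (quotPow J t) N n →ₗ[R] (colimit (lcDiagramEval J N n) :) :=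
  (colimit.ι (lcDiagramEval J N n) (op (op t))).hom ∘ₗ (evalEquiv J N n t).symm.toLinearMap

theorem toColimit_evalEquiv (t : ℕ) (x : (lcDiagramEval J N n).obj (op (op t))) :
    toColimit J N n t (evalEquiv J N n t x) = colimit.ι (lcDiagramEval J N n) (op (op t)) x :=
  congrArg (colimit.ι (lcDiagramEval J N n) (op (op t)))
    ((evalEquiv J N n t).symm_apply_apply x)

theorem toColimit_comp {s t : ℕ} (h : s ≤ t) (α : Ext (quotPow J s) N n) :
    toColimit J N n t ((Ext.mk₀ (quotPowMap J h)).comp α (zero_add n)) = toColimit J N n s α := by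
  obtain ⟨x, rfl⟩ := (evalEquiv J N n s).surjective α
  let f : op (op s) ⟶ op (op t) := (homOfLE h).op.op
  rw [← evalEquiv_map J N n h f, toColimit_evalEquiv, toColimit_evalEquiv]
  exact ConcreteCategory.congr_hom (colimit.w (lcDiagramEval J N n) f) x

/-- The comparison of the direct limit with the colimit. -/
def extColimToColimit : ExtColim J N n →ₗ[R] (colimit (lcDiagramEval J N n) :) :=
  Module.DirectLimit.lift R ℕ (fun t : ℕ => Ext (quotPow J t) N n) (quotPowExtMap J N n)
    (toColimit J N n) (fun _ _ h α => toColimit_comp J N n h α)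

theorem extColimToColimit_of (t : ℕ) (α : Ext (quotPow J t) N n) :
    extColimToColimit J N n (ExtColim.of J N n t α) = toColimit J N n t α :=
  Module.DirectLimit.lift_of (f := quotPowExtMap J N n) (toColimit J N n)
    (fun _ _ h α => toColimit_comp J N n h α) α

theorem extColimToColimit_bijective : Function.Bijective (extColimToColimit J N n) := by
  constructor
  · rw [injective_iff_map_eq_zero]
    intro z hz
    obtain ⟨t, α, rfl⟩ := ExtColim.exists_of J z
    obtain ⟨x, rfl⟩ := (evalEquiv J N n t).surjective α
    rw [extColimToColimit_of, toColimit_evalEquiv] at hz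
    obtain ⟨j, f, hf⟩ := Concrete.colimit_rep_eq_zero R (lcDiagramEval J N n) _ _ hz
    have h : t ≤ j.unop.unop := leOfHom f.unop.unop
    rw [ExtColim.of_eq_zero_iff]
    refine ⟨_, h, ?_⟩
    rw [← evalEquiv_map J N n h f]
    exact (congrArg (evalEquiv J N n _) hf).trans (map_zero _)
  · intro y
    obtain ⟨j, x, rfl⟩ := Concrete.colimit_exists_rep (lcDiagramEval J N n) y
    exact ⟨ExtColim.of J N n j.unop.unop (evalEquiv J N n _ x),
      (extColimToColimit_of J N n _ _).trans (toColimit_evalEquiv J N n _ x)⟩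

/-- Local cohomology is the direct limit of `Ext^n(R / J ^ t, N)`. -/
def localCohomologyIso :
    (localCohomology J n).obj N ≅ ModuleCat.of R (ExtColim J N n) :=
  localCohomologyObjIso J N n ≪≫
    (LinearEquiv.ofBijective _ (extColimToColimit_bijective J N n)).symm.toModuleIso

end Comparison

section TopLocalCohomology

open Abelian

variable {R : Type} [CommRing R] (J : Ideal R)

/-- `N` admits a weakly regular sequence of length `d` in `J`, modulo which it is killed by a
power of `J`. -/
def HasTorsionQuotient (J : Ideal R) : ℕ → ModuleCat.{0} R → Prop
  | 0, N => ∃ s, ∀ r ∈ J ^ s, ∀ y : N, r • y = 0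
  | d + 1, N => ∃ x ∈ J, IsSMulRegular N x ∧
      HasTorsionQuotient J d (ModuleCat.of R (QuotSMulTop x N))

namespace ExtColim

variable {J} {N : ModuleCat.{0} R}

theorem exact_postcomp_g_extClass {S : ShortComplex (ModuleCat.{0} R)} (hS : S.ShortExact) (n : ℕ) :
    Function.Exact (postcomp J (Ext.mk₀ S.g) (add_zero n))
      (postcomp J hS.extClass (rfl : n + 1 = _)) :=
  exact_postcomp J _ _ _ _ hS.comp_extClass
    fun X α h => Ext.covariant_sequence_exact₃ X hS α rfl h

theorem exact_postcomp_extClass_f {S : ShortComplex (ModuleCat.{0} R)} (hS : S.ShortExact) (n : ℕ) :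
    Function.Exact (postcomp J hS.extClass (rfl : n + 1 = _))
      (postcomp J (Ext.mk₀ S.f) (add_zero (n + 1))) :=
  exact_postcomp J _ _ _ _ hS.extClass_comp
    fun X α h => Ext.covariant_sequence_exact₁ X hS α h rfl

theorem exact_postcomp_f_g {S : ShortComplex (ModuleCat.{0} R)} (hS : S.ShortExact) (n : ℕ) :
    Function.Exact (postcomp J (Ext.mk₀ S.f) (add_zero n))
      (postcomp J (Ext.mk₀ S.g) (add_zero n)) :=
  exact_postcomp J _ _ _ _ (by rw [Ext.mk₀_comp_mk₀, S.zero, Ext.mk₀_zero])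
    fun X α h => Ext.covariant_sequence_exact₂ X hS α h

theorem subsingleton_of_smul_injective {n : ℕ} {x : R} (hx : x ∈ J)
    (h : ∀ z : ExtColim J N n, x • z = 0 → z = 0) : Subsingleton (ExtColim J N n) := by
  refine subsingleton_of_forall_eq 0 fun z => ?_
  obtain ⟨t, ht⟩ := exists_pow_smul_eq_zero J z
  have h0 : x ^ t • z = 0 := ht _ (Ideal.pow_mem_pow hx t)
  clear ht
  induction t with
  | zero => simpa using h0
  | succ t ih => exact ih (h _ (by rwa [smul_smul, ← pow_succ']))

theorem subsingleton_zero_of_isSMulRegular {x : R} (hx : x ∈ J) (hreg : IsSMulRegular N x) :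
    Subsingleton (ExtColim J N 0) := by
  refine subsingleton_of_smul_injective hx fun z hz => ?_
  obtain ⟨t, α, rfl⟩ := exists_of J z
  rw [← postcomp_smul_id, postcomp_of, of_eq_zero_iff] at hz
  obtain ⟨u, htu, hu⟩ := hz
  rw [of_eq_zero_iff]
  refine ⟨u, htu, ?_⟩
  have : Mono (x • 𝟙 N) := hreg.smulShortComplex_shortExact.mono_f
  refine Ext.postcomp_mk₀_injective_of_mono (quotPow J u) (x • 𝟙 N) ?_
  refine Eq.trans ?_ (hu.trans (map_zero _).symm)
  exact Ext.comp_assoc _ _ _ (zero_add 0) (add_zero 0) (by omega)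

/-- The connecting map attached to a regular element `x`. -/
def connecting (J : Ideal R) {x : R} (hreg : IsSMulRegular N x) (n : ℕ) :
    ExtColim J (ModuleCat.of R (QuotSMulTop x N)) n →ₗ[R] ExtColim J N (n + 1) :=
  postcomp J (N := ModuleCat.of R (QuotSMulTop x N)) (N' := N)
    hreg.smulShortComplex_shortExact.extClass rfl

theorem smul_eq_zero_iff_exists_connecting_eq {x : R} (hreg : IsSMulRegular N x) {n : ℕ}
    (z : ExtColim J N (n + 1)) : x • z = 0 ↔ ∃ y, connecting J hreg n y = z := by
  rw [← postcomp_smul_id]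
  exact exact_postcomp_extClass_f hreg.smulShortComplex_shortExact n z

theorem connecting_injective {x : R} (hreg : IsSMulRegular N x) {n : ℕ}
    [Subsingleton (ExtColim J N n)] : Function.Injective (connecting J hreg n) := by
  rw [injective_iff_map_eq_zero]
  intro z hz
  obtain ⟨y, rfl⟩ := (exact_postcomp_g_extClass hreg.smulShortComplex_shortExact n z).1 hz
  have hy : y = 0 := Subsingleton.elim (α := ExtColim J N n) _ _
  exact (congrArg _ hy).trans (map_zero _)

theorem smul_surjective {x : R} (hreg : IsSMulRegular N x) {n : ℕ}
    [Subsingleton (ExtColim J (ModuleCat.of R (QuotSMulTop x N)) n)] (z : ExtColim J N n) :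
    ∃ y : ExtColim J N n, x • y = z := by
  obtain ⟨y, hy⟩ := (exact_postcomp_f_g hreg.smulShortComplex_shortExact n z).1
    (Subsingleton.elim (α := ExtColim J (ModuleCat.of R (QuotSMulTop x N)) n) _ _)
  exact ⟨y, (postcomp_smul_id J x _).symm.trans hy⟩

theorem subsingleton_succ_of_isSMulRegular {x : R} (hx : x ∈ J) (hreg : IsSMulRegular N x)
    {n : ℕ} [Subsingleton (ExtColim J (ModuleCat.of R (QuotSMulTop x N)) n)] :
    Subsingleton (ExtColim J N (n + 1)) := by
  refine subsingleton_of_smul_injective hx fun z hz => ?_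
  obtain ⟨y, rfl⟩ := (smul_eq_zero_iff_exists_connecting_eq hreg z).1 hz
  rw [Subsingleton.elim y 0, map_zero]

/-- The short exact sequence `J ^ t ⟶ R ⟶ R / J ^ t`. -/
def powShortComplex (J : Ideal R) (t : ℕ) : ShortComplex (ModuleCat.{0} R) :=
  ModuleCat.shortComplexOfCompEqZero (J ^ t).subtype (J ^ t).mkQ (by
    ext y
    exact Ideal.Quotient.eq_zero_iff_mem.2 y.2)

theorem powShortComplex_shortExact (t : ℕ) : (powShortComplex J t).ShortExact where
  exact := by
    refine ModuleCat.shortComplex_exact _ ?_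
    exact LinearMap.exact_subtype_mkQ _
  mono_f := (ModuleCat.mono_iff_injective _).2 (J ^ t).subtype_injective
  epi_g := (ModuleCat.epi_iff_surjective _).2 (J ^ t).mkQ_surjective

/-- The transition maps between the sequences `J ^ t ⟶ R ⟶ R / J ^ t`. -/
def powShortComplexMap {s t : ℕ} (h : s ≤ t) : powShortComplex J t ⟶ powShortComplex J s where
  τ₁ := ModuleCat.ofHom (Submodule.inclusion (Ideal.pow_le_pow_right h))
  τ₂ := 𝟙 _
  τ₃ := quotPowMap J h
  comm₁₂ := by ext; rfl
  comm₂₃ := by ext; rfl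

theorem subsingleton_one_of_torsion {s : ℕ} (hs : ∀ r ∈ J ^ s, ∀ y : N, r • y = 0) :
    Subsingleton (ExtColim J N 1) := by
  refine subsingleton_of_forall_eq 0 fun z => ?_
  obtain ⟨t, α, rfl⟩ := exists_of J z
  have : Projective (powShortComplex J t).X₂ :=
    inferInstanceAs (Projective (ModuleCat.of R R))
  obtain ⟨f, rfl⟩ := Ext.contravariant_sequence_exact₃ (powShortComplex_shortExact t) N α
    (Ext.eq_zero_of_projective _) (add_zero 1)
  obtain ⟨f, rfl⟩ := Ext.homEquiv₀.symm.surjective f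
  have h : t ≤ s + t := Nat.le_add_left t s
  refine (of_eq_zero_iff J).2 ⟨s + t, h, ?_⟩
  have h1 := ShortComplex.ShortExact.extClass_naturality (powShortComplex_shortExact (s + t))
    (powShortComplex_shortExact t) (powShortComplexMap (J := J) h)
  have h2 : (powShortComplexMap (J := J) h).τ₁ ≫ f = 0 := by
    ext y
    obtain ⟨y, hy⟩ := y
    change f.hom (⟨y, _⟩ : (J ^ t : Ideal R)) = 0
    have hy' : y ∈ (J ^ s) • (J ^ t) := by rwa [smul_eq_mul, ← pow_add]
    suffices ∀ (hyt : y ∈ J ^ t), f.hom (⟨y, hyt⟩ : (J ^ t : Ideal R)) = 0 from this _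
    refine Submodule.smul_induction_on' hy' ?_ ?_
    · intro r hr w hw hyt
      exact (map_smul f.hom r (⟨w, hw⟩ : (J ^ t : Ideal R))).trans (hs r hr _)
    · intro a ha b hb iha ihb hyt
      have ha' := Ideal.mul_le_right ha
      have hb' := Ideal.mul_le_right hb
      refine (map_add f.hom (⟨a, ha'⟩ : (J ^ t : Ideal R)) ⟨b, hb'⟩).trans ?_
      exact (congrArg₂ (· + ·) (iha ha') (ihb hb')).trans (add_zero 0)
  have h3 := congrArg (fun β => β.comp (Ext.mk₀ f) (add_zero 1)) h1
  refine (Ext.comp_assoc _ _ _ (zero_add 1) (add_zero 1) (by omega)).symm.trans (h3.symm.trans ?_)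
  refine (Ext.comp_assoc _ _ _ (add_zero 1) (add_zero 0) (by omega)).trans ?_
  have h4 : (Ext.mk₀ (powShortComplexMap (J := J) h).τ₁).comp (Ext.mk₀ f) (add_zero 0) = 0 := by
    rw [Ext.mk₀_comp_mk₀, h2, Ext.mk₀_zero]
  exact (congrArg (fun β => Ext.comp _ β (add_zero 1)) h4).trans (Ext.comp_zero ..)

/-- The morphism `R / J ^ s ⟶ N` with value `y` at `1`. -/
def quotPowLift {s : ℕ} (hs : ∀ r ∈ J ^ s, ∀ y : N, r • y = 0) : N →ₗ[R] (quotPow J s ⟶ N) where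
  toFun y := ModuleCat.ofHom
    (Submodule.liftQ (J ^ s) (LinearMap.toSpanSingleton R N y) (fun r hr => hs r hr y))
  map_add' y y' := by
    ext
    change (1 : R) • (y + y') = (1 : R) • y + (1 : R) • y'
    rw [smul_add]
  map_smul' r y := by
    ext
    change (1 : R) • r • y = r • (1 : R) • y
    rw [one_smul, one_smul]

theorem quotPowLift_apply_one {s : ℕ} (hs : ∀ r ∈ J ^ s, ∀ y : N, r • y = 0) (y : N) :
    (quotPowLift hs y).hom (1 : R ⧸ J ^ s) = y :=
  one_smul R y

theorem quotPow_hom_ext {s : ℕ} {f g : quotPow J s ⟶ N}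
    (h : f.hom (1 : R ⧸ J ^ s) = g.hom (1 : R ⧸ J ^ s)) : f = g := by
  ext
  exact h

/-- If a power of `J` kills `N`, then `N` is the direct limit of the `Hom(R / J ^ t, N)`. -/
theorem nonempty_linearEquiv_of_torsion {s : ℕ} (hs : ∀ r ∈ J ^ s, ∀ y : N, r • y = 0) :
    Nonempty (N ≃ₗ[R] ExtColim J N 0) := by
  refine ⟨LinearEquiv.ofBijective
    (of J N 0 s ∘ₗ (Ext.linearEquiv₀ (R := R)).symm.toLinearMap ∘ₗ quotPowLift hs) ⟨?_, ?_⟩⟩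
  · rw [injective_iff_map_eq_zero]
    intro y hy
    obtain ⟨u, hu, h0⟩ := (of_eq_zero_iff (α := Ext.mk₀ (quotPowLift hs y)) J).1 hy
    rw [Ext.mk₀_comp_mk₀, ← Ext.mk₀_zero, (Ext.mk₀_bijective _ _).1.eq_iff] at h0
    have := congrArg (fun f => f.hom (1 : R ⧸ J ^ u)) h0
    exact (quotPowLift_apply_one hs y).symm.trans this
  · intro z
    obtain ⟨t, α, rfl⟩ := exists_of J z
    obtain ⟨f, rfl⟩ := (Ext.mk₀_bijective _ _).2 α
    refine ⟨f.hom (1 : R ⧸ J ^ t), ?_⟩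
    have h1 := of_comp (n := 0) (N := N) J (Nat.le_add_right s t)
      (Ext.mk₀ (quotPowLift hs (f.hom (1 : R ⧸ J ^ t))))
    have h2 := of_comp (n := 0) (N := N) J (Nat.le_add_left t s) (Ext.mk₀ f)
    rw [Ext.mk₀_comp_mk₀] at h1 h2
    refine h1.symm.trans (Eq.trans ?_ h2)
    congr 2
    refine quotPow_hom_ext ?_
    exact quotPowLift_apply_one hs _

theorem subsingleton_of_hasTorsionQuotient {d : ℕ} (hN : HasTorsionQuotient J d N) {i : ℕ}
    (hi : i < d) : Subsingleton (ExtColim J N i) := by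
  induction d generalizing N i with
  | zero => omega
  | succ d ih =>
    obtain ⟨x, hx, hreg, hN⟩ := hN
    cases i with
    | zero => exact subsingleton_zero_of_isSMulRegular hx hreg
    | succ i =>
      have := ih hN (i := i) (by omega)
      exact subsingleton_succ_of_isSMulRegular hx hreg

theorem subsingleton_succ_of_hasTorsionQuotient {d : ℕ} (hN : HasTorsionQuotient J d N) :
    Subsingleton (ExtColim J N (d + 1)) := by
  induction d generalizing N with
  | zero => exact subsingleton_one_of_torsion hN.choose_spec
  | succ d ih =>
    obtain ⟨x, hx, hreg, hN⟩ := hN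
    have := ih hN
    exact subsingleton_succ_of_isSMulRegular hx hreg

/-- The sequence formed by the top local cohomology of `N` and multiplication by `x`. -/
def topShortComplex (J : Ideal R) {x : R} (hreg : IsSMulRegular N x) (d : ℕ) :
    ShortComplex (ModuleCat.{0} R) where
  X₁ := ModuleCat.of R (ExtColim J (ModuleCat.of R (QuotSMulTop x N)) d)
  X₂ := ModuleCat.of R (ExtColim J N (d + 1))
  X₃ := ModuleCat.of R (ExtColim J N (d + 1))
  f := ModuleCat.ofHom (connecting J hreg d)
  g := x • 𝟙 _
  zero := by
    refine ModuleCat.hom_ext (LinearMap.ext fun y => ?_)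
    exact (smul_eq_zero_iff_exists_connecting_eq hreg _).2 ⟨y, rfl⟩

theorem topShortComplex_shortExact {x : R} (hx : x ∈ J) (hreg : IsSMulRegular N x) {d : ℕ}
    (hN : HasTorsionQuotient J d (ModuleCat.of R (QuotSMulTop x N))) :
    (topShortComplex J hreg d).ShortExact where
  exact := by
    rw [ShortComplex.moduleCat_exact_iff]
    intro z hz
    exact (smul_eq_zero_iff_exists_connecting_eq hreg z).1 hz
  mono_f := by
    have := subsingleton_of_hasTorsionQuotient (N := N) (d := d + 1) ⟨x, hx, hreg, hN⟩
      (Nat.lt_succ_self d)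
    rw [ModuleCat.mono_iff_injective]
    exact connecting_injective hreg
  epi_g := by
    have := subsingleton_succ_of_hasTorsionQuotient hN
    rw [ModuleCat.epi_iff_surjective]
    exact smul_surjective hreg

end ExtColim

end TopLocalCohomology

section Numerics

open Abelian IsLocalRing

variable {R : Type} [CommRing R] [IsLocalRing R] {N : ModuleCat.{0} R} {x : R}

theorem bassLength_zero_quotSMulTop (hx : x ∈ maximalIdeal R) (hreg : IsSMulRegular N x) :
    bassLength 0 (ModuleCat.of R (QuotSMulTop x N)) = bassLength 0 N :=
  length_ext_zero_of_precomp_f_eq_zero hreg.smulShortComplex_shortExact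
    (mk₀_smul_id_comp_ext_resCat hx)

theorem bassLength_succ_quotSMulTop (hx : x ∈ maximalIdeal R) (hreg : IsSMulRegular N x) (n : ℕ) :
    bassLength (n + 1) (ModuleCat.of R (QuotSMulTop x N)) =
      bassLength n N + bassLength (n + 1) N :=
  length_ext_succ_of_precomp_f_eq_zero hreg.smulShortComplex_shortExact
    (mk₀_smul_id_comp_ext_resCat hx) (mk₀_smul_id_comp_ext_resCat hx)

namespace ExtColim

variable {d : ℕ}

theorem bassLength_zero_succ (hx : x ∈ maximalIdeal R) (hreg : IsSMulRegular N x)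
    (hN : HasTorsionQuotient (maximalIdeal R) d (ModuleCat.of R (QuotSMulTop x N))) :
    bassLength 0 (ModuleCat.of R (ExtColim (maximalIdeal R) N (d + 1))) = 0 :=
  length_ext_zero_of_precomp_g_eq_zero (topShortComplex_shortExact hx hreg hN)
    (mk₀_smul_id_comp_ext_resCat hx)

theorem bassLength_quotSMulTop (hx : x ∈ maximalIdeal R) (hreg : IsSMulRegular N x)
    (hN : HasTorsionQuotient (maximalIdeal R) d (ModuleCat.of R (QuotSMulTop x N))) (n : ℕ) :
    bassLength n (ModuleCat.of R
        (ExtColim (maximalIdeal R) (ModuleCat.of R (QuotSMulTop x N)) d)) =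
      bassLength n (ModuleCat.of R (ExtColim (maximalIdeal R) N (d + 1))) +
        bassLength (n + 1) (ModuleCat.of R (ExtColim (maximalIdeal R) N (d + 1))) :=
  length_ext_of_precomp_g_eq_zero (topShortComplex_shortExact hx hreg hN)
    (mk₀_smul_id_comp_ext_resCat hx) (mk₀_smul_id_comp_ext_resCat hx)

/-- The dimensions of `Ext(-, k)` of the top local cohomology of `N` are those of `N`, shifted. -/
theorem bassLength_top [IsNoetherianRing R] {N : ModuleCat.{0} R} [hfg : Module.Finite R N]
    (hN : HasTorsionQuotient (maximalIdeal R) d N) :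
    (∀ i < d, bassLength i (ModuleCat.of R (ExtColim (maximalIdeal R) N d)) = 0) ∧
      ∀ i, bassLength (i + d) (ModuleCat.of R (ExtColim (maximalIdeal R) N d)) =
        bassLength i N := by
  induction d generalizing N with
  | zero =>
    refine ⟨fun i hi => absurd hi (Nat.not_lt_zero i), fun i => ?_⟩
    obtain ⟨e⟩ := nonempty_linearEquiv_of_torsion hN.choose_spec
    exact (bassLength_eq_of_iso e.toModuleIso i).symm
  | succ d ih =>
    obtain ⟨x, hx, hreg, hN⟩ := hN
    have : Module.Finite R (ModuleCat.of R (QuotSMulTop x N)) :=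
      inferInstanceAs (Module.Finite R (QuotSMulTop x N))
    obtain ⟨ih₁, ih₂⟩ := ih hN
    have hvan : ∀ i < d + 1,
        bassLength i (ModuleCat.of R (ExtColim (maximalIdeal R) N (d + 1))) = 0 := by
      intro i hi
      cases i with
      | zero => exact bassLength_zero_succ hx hreg hN
      | succ i =>
        have h := bassLength_quotSMulTop hx hreg hN i
        rw [ih₁ i (by omega), eq_comm, add_eq_zero] at h
        exact h.2
    refine ⟨hvan, fun i => ?_⟩
    induction i with
    | zero =>
      have h := bassLength_quotSMulTop hx hreg hN d
      rw [hvan d (Nat.lt_succ_self d), zero_add] at h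
      have h2 := ih₂ 0
      rw [zero_add, bassLength_zero_quotSMulTop hx hreg] at h2
      rw [zero_add, ← h, h2]
    | succ i hi =>
      have h := bassLength_quotSMulTop hx hreg hN (i + 1 + d)
      rw [ih₂ (i + 1), bassLength_succ_quotSMulTop hx hreg, Nat.add_right_comm i 1 d,
        add_assoc i d 1,
        hi] at h
      rw [Nat.add_right_comm i 1 (d + 1)]
      exact ((add_right_inj_of_ne_top (bassLength_ne_top N i)).1 h).symm

end ExtColim

end Numerics

section CohenMacaulay

theorem subsingleton_ext_of_lt_edepth {R : Type} [CommRing R]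
    {k N : ModuleCat.{0} R} {d : ℕ}
    (h : edepth R k N = (d : EReal)) {i : ℕ} (hi : i < d) : Subsingleton (Abelian.Ext k N i) := by
  rw [← (extEquiv k N i).toEquiv.subsingleton_congr, ← not_nontrivial_iff_subsingleton]
  intro hn
  have h1 : edepth R k N ≤ (i : EReal) := sInf_le ⟨i, rfl, hn⟩
  rw [h, EReal.natCast_le_iff] at h1
  omega

open Abelian IsLocalRing RingTheory.Sequence

variable {R : Type} [CommRing R] [IsLocalRing R]

theorem exists_pow_smul_eq_zero_of_supportDim_eq_zero [IsNoetherianRing R]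
    (N : Type) [AddCommGroup N] [Module R N]
    [Module.Finite R N] (h : Module.supportDim R N = 0) :
    ∃ s, ∀ r ∈ maximalIdeal R ^ s, ∀ y : N, r • y = 0 := by
  have h1 := support_of_supportDim_eq_zero R N h
  rw [Module.support_eq_zeroLocus, PrimeSpectrum.zeroLocus_eq_iff,
    (maximalIdeal.isMaximal R).isPrime.radical] at h1
  obtain ⟨s, hs⟩ := Ideal.exists_radical_pow_le_of_fg (Module.annihilator R N)
    (IsNoetherian.noetherian _)
  rw [h1] at hs
  exact ⟨s, fun r hr => Module.mem_annihilator.1 (hs hr)⟩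

theorem hasTorsionQuotient_of_isWeaklyRegular [IsNoetherianRing R] (rs : List R)
    (hrs : ∀ r ∈ rs, r ∈ maximalIdeal R)
    (N : Type) [AddCommGroup N] [Module R N] [Module.Finite R N] (hreg : IsWeaklyRegular N rs)
    (hdim : Module.supportDim R N = (rs.length : ℕ)) :
    HasTorsionQuotient (maximalIdeal R) rs.length (ModuleCat.of R N) := by
  induction rs generalizing N with
  | nil => exact exists_pow_smul_eq_zero_of_supportDim_eq_zero N hdim
  | cons x rs ih =>
    rw [isWeaklyRegular_cons_iff] at hreg
    have hx := hrs x List.mem_cons_self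
    refine ⟨x, hx, hreg.1, ih (fun r hr => hrs r (List.mem_cons_of_mem x hr)) _ hreg.2 ?_⟩
    rw [← Module.supportDim_quotSMulTop_succ_eq_supportDim hreg.1 hx, List.length_cons] at hdim
    exact ENat.WithBot.add_natCast_cancel.mp hdim

theorem top_ne_maximalIdeal_smul_top (N : Type) [AddCommGroup N] [Module R N] [Module.Finite R N]
    [Nontrivial N] : (⊤ : Submodule R N) ≠ maximalIdeal R • ⊤ :=
  Submodule.top_ne_ideal_smul_of_le_jacobson_annihilator (maximalIdeal_le_jacobson _)

theorem hasTorsionQuotient_of_edepth_eq [IsNoetherianRing R] (N : Type) [AddCommGroup N]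
    [Module R N] [Module.Finite R N] [Nontrivial N] {d : ℕ}
    (hdepth : edepth R (resCat R) (ModuleCat.of R N) = (d : EReal))
    (hdim : Module.supportDim R N = d) :
    HasTorsionQuotient (maximalIdeal R) d (ModuleCat.of R N) := by
  have : Module.Finite R (resCat R) := inferInstanceAs (Module.Finite R (R ⧸ maximalIdeal R))
  have hsupp : Module.support R (resCat R) =
      PrimeSpectrum.zeroLocus (maximalIdeal R : Set R) := by
    have h := Module.support_eq_zeroLocus (R := R) (M := R ⧸ maximalIdeal R)
    rwa [Ideal.annihilator_quotient] at h
  obtain ⟨rs, rfl, hrs, hreg⟩ := ModuleCat.exists_isRegular_of_exists_subsingleton_ext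
    (maximalIdeal R) d (ModuleCat.of R N) (top_ne_maximalIdeal_smul_top N).symm.lt_top
    (resCat R) hsupp fun i hi => subsingleton_ext_of_lt_edepth hdepth hi
  exact hasTorsionQuotient_of_isWeaklyRegular rs hrs N hreg.toIsWeaklyRegular hdim

theorem length_tor_dual (i : ℕ) (M : ModuleCat.{0} R) :
    Module.length R (torModule R i (resCat R) M →ₗ[R] ResidueField R) = bassLength i M :=
  (torDualEquiv M i).length_eq

theorem nonempty_tor_iso {i j : ℕ} {M N : ModuleCat.{0} R} (h : bassLength i M = bassLength j N)
    (hfin : bassLength j N ≠ ⊤) :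
    Nonempty (torModule R i (resCat R) M ≅ torModule R j (resCat R) N) := by
  obtain ⟨e⟩ := nonempty_linearEquiv_of_length_dual_eq
    (V := torModule R i (resCat R) M) (W := torModule R j (resCat R) N)
    (fun r hr => smul_torModule_eq_zero i hr) (fun r hr => smul_torModule_eq_zero j hr)
    (by rw [length_tor_dual, length_tor_dual, h]) (by rwa [length_tor_dual, h])
  exact ⟨e.toModuleIso⟩

theorem subsingleton_tor {i : ℕ} {M : ModuleCat.{0} R} (h : bassLength i M = 0) :
    Subsingleton (torModule R i (resCat R) M) :=
  subsingleton_of_length_dual_eq_zero (fun r hr => smul_torModule_eq_zero i hr)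
    (by rw [length_tor_dual, h])

theorem length_dual_quotient_maximalIdeal_smul (N : Type) [AddCommGroup N] [Module R N] :
    Module.length R (N ⧸ (maximalIdeal R • (⊤ : Submodule R N)) →ₗ[R] ResidueField R) =
      bassLength 0 (ModuleCat.of R N) := by
  have hmem : ∀ f : N →ₗ[R] ResidueField R,
      maximalIdeal R • (⊤ : Submodule R N) ≤ LinearMap.ker f := by
    intro f
    rw [Submodule.smul_le]
    intro r hr y _
    rw [LinearMap.mem_ker, map_smul, Algebra.smul_def, ResidueField.algebraMap_eq,
      (residue_eq_zero_iff r).2 hr, zero_mul]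
  let e : (N ⧸ (maximalIdeal R • (⊤ : Submodule R N)) →ₗ[R] ResidueField R) ≃ₗ[R]
      (N →ₗ[R] ResidueField R) :=
    LinearEquiv.ofBijective
      (LinearMap.lcomp R (ResidueField R) (maximalIdeal R • (⊤ : Submodule R N)).mkQ)
      ⟨fun f g h => Submodule.linearMap_qext _ h,
        fun f => ⟨Submodule.liftQ _ f (hmem f), Submodule.liftQ_mkQ _ f (hmem f)⟩⟩
  exact (e ≪≫ₗ (ModuleCat.homLinearEquiv (S := R) (M := ModuleCat.of R N) (N := resCat R)).symm ≪≫ₗ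
    (Ext.linearEquiv₀ (R := R) (X := ModuleCat.of R N) (Y := resCat R)).symm).length_eq

theorem nonempty_tor_iso_quotient {i : ℕ} {M : ModuleCat.{0} R} (N : Type) [AddCommGroup N]
    [Module R N] (h : bassLength i M = bassLength 0 (ModuleCat.of R N))
    (hfin : bassLength 0 (ModuleCat.of R N) ≠ ⊤) :
    Nonempty (torModule R i (resCat R) M ≅
      ModuleCat.of R (N ⧸ (maximalIdeal R • (⊤ : Submodule R N)))) := by
  obtain ⟨e⟩ := nonempty_linearEquiv_of_length_dual_eq (V := torModule R i (resCat R) M)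
    (W := N ⧸ (maximalIdeal R • (⊤ : Submodule R N)))
    (fun r hr => smul_torModule_eq_zero i hr)
    (fun r hr w => by
      obtain ⟨y, rfl⟩ := Submodule.Quotient.mk_surjective _ w
      rw [← Submodule.Quotient.mk_smul, Submodule.Quotient.mk_eq_zero]
      exact Submodule.smul_mem_smul hr trivial)
    (by rw [length_tor_dual, length_dual_quotient_maximalIdeal_smul, h])
    (by rwa [length_tor_dual, h])
  exact ⟨e.toModuleIso⟩

end CohenMacaulay

/-- `(R, m, k)` local noetherian, `N` finitely generated Cohen–Macaulay of
dimension `d` (depth `N` = dim (supp `N`) = `d`), `M := H^d_m(N)`. Then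
`Tor_i^R(k, M) ≅ Tor_{i-d}^R(k, N)` for `i ≥ d`, `Tor_i^R(k, M) = 0` for `i < d`, and
`Tor_d^R(k, M) ≅ N/mN ≠ 0`. -/
theorem tor_of_top_localCohomology_CM
    (R : Type) [CommRing R] [IsNoetherianRing R] [IsLocalRing R]
    (N : Type) [AddCommGroup N] [Module R N] [Module.Finite R N] (d : ℕ)
    (hdepth : edepth R (ModuleCat.of R (IsLocalRing.ResidueField R)) (ModuleCat.of R N)
      = (d : EReal))
    (hdim : Order.krullDim (Module.support R N) = (d : WithBot ℕ∞)) :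
    (∀ i : ℕ, d ≤ i → Nonempty
      ((torModule R i (ModuleCat.of R (IsLocalRing.ResidueField R))
          ((localCohomology (IsLocalRing.maximalIdeal R) d).obj (ModuleCat.of R N)))
        ≅ torModule R (i - d) (ModuleCat.of R (IsLocalRing.ResidueField R))
            (ModuleCat.of R N))) ∧
    (∀ i : ℕ, i < d → Subsingleton
      (torModule R i (ModuleCat.of R (IsLocalRing.ResidueField R))
        ((localCohomology (IsLocalRing.maximalIdeal R) d).obj (ModuleCat.of R N)))) ∧
    Nonempty
      ((torModule R d (ModuleCat.of R (IsLocalRing.ResidueField R))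
          ((localCohomology (IsLocalRing.maximalIdeal R) d).obj (ModuleCat.of R N)))
        ≅ ModuleCat.of R
            (N ⧸ (IsLocalRing.maximalIdeal R • (⊤ : Submodule R N)))) ∧
    Nontrivial (N ⧸ (IsLocalRing.maximalIdeal R • (⊤ : Submodule R N))) := by
  have hdim' : Module.supportDim R N = d := hdim
  have hN : Nontrivial N := by
    rw [← Module.supportDim_ne_bot_iff_nontrivial R, hdim']
    exact WithBot.coe_ne_bot
  obtain ⟨hlt, hge⟩ :=
    ExtColim.bassLength_top (hasTorsionQuotient_of_edepth_eq N hdepth hdim')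
  have hiso := bassLength_eq_of_iso
    (localCohomologyIso (IsLocalRing.maximalIdeal R) (ModuleCat.of R N) d)
  refine ⟨fun i hi => ?_, fun i hi => ?_, ?_, ?_⟩
  · refine nonempty_tor_iso ((hiso i).trans ?_) (bassLength_ne_top _ _)
    conv_lhs => rw [← Nat.sub_add_cancel hi]
    exact hge (i - d)
  · exact subsingleton_tor ((hiso i).trans (hlt i hi))
  · refine nonempty_tor_iso_quotient N ((hiso d).trans ?_) (bassLength_ne_top _ _)
    simpa only [zero_add] using hge 0
  · exact Submodule.Quotient.nontrivial_iff.2 (top_ne_maximalIdeal_smul_top N).symm
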